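/- arXiv:2107.11854 — 2 statements merged into one kernel-verified Lean document; each statement's English description precedes it below -/
import Mathlib

section
/- Let 0 < p₀, p < ∞, 1 < q₀ < q < ∞ with q/p = q₀/p₀, and let f, g be measurable functions on (0,∞) whose supports have finite Lebesgue measure and which satisfy ∫₀^∞ (f*(t)^{q₀} − g*(t)^{q₀}) d(t^{q₀/p₀}) ≥ 0. Suppose that f, g ∈ L(p,q) and that there exists τ₁ ∈ [0,∞) such that ∫_τ^∞ λ_g(s)^{q₀/p₀} ds ≤ ∫_τ^∞ λ_f(s)^{q₀/p₀} ds for all τ ≥ τ₁, and ∫_τ^∞ λ_f(s)^{q₀/p₀} ds ≤ ∫_τ^∞ λ_g(s)^{q₀/p₀} ds for all τ ≤ τ₁. Then ‖g‖_{L(p,q)} ≤ ‖f‖_{L(p,q)}. -/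
open MeasureTheory Set Real Filter
open scoped ENNReal NNReal

/-- The distribution function `λ_f(τ) = |{t > 0 : |f t| > τ}|` of a function on `(0,∞)`
with respect to Lebesgue measure. -/
noncomputable def distribFn (f : ℝ → ℝ) (τ : ℝ) : ℝ≥0∞ :=
  (volume.restrict (Set.Ioi (0:ℝ))) {t : ℝ | τ < |f t|}

/-- The non-increasing rearrangement `f*(s) = inf{τ > 0 : λ_f(τ) ≤ s}`. -/
noncomputable def rearr (f : ℝ → ℝ) (s : ℝ) : ℝ :=
  sInf {τ : ℝ | 0 < τ ∧ distribFn f τ ≤ ENNReal.ofReal s}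

/-- Condition (D): there is `τ₀ ∈ (0,∞)` such that `λ_f(τ) ≤ λ_g(τ)` for `τ < τ₀` and
`λ_f(τ) ≥ λ_g(τ)` for `τ > τ₀`. -/
def CondD (f g : ℝ → ℝ) : Prop :=
  ∃ τ₀ : ℝ, 0 < τ₀ ∧ (∀ τ : ℝ, 0 < τ → τ < τ₀ → distribFn f τ ≤ distribFn g τ) ∧
    (∀ τ : ℝ, τ₀ < τ → distribFn g τ ≤ distribFn f τ)

theorem distribFn_antitone (f : ℝ → ℝ) : Antitone (distribFn f) := fun _ _ hab =>
  measure_mono fun _ ht => lt_of_le_of_lt hab ht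

theorem distribFn_le_support (f : ℝ → ℝ) {τ : ℝ} (hτ : 0 ≤ τ) :
    distribFn f τ ≤ (volume.restrict (Set.Ioi (0:ℝ))) {t : ℝ | f t ≠ 0} :=
  measure_mono fun _ ht => abs_pos.1 (lt_of_le_of_lt hτ ht)

/-- Right-continuity of the distribution function, in the form used for rearrangements. -/
theorem distribFn_le_of_forall_gt (f : ℝ → ℝ) {τ : ℝ} {c : ℝ≥0∞}
    (h : ∀ σ, τ < σ → distribFn f σ ≤ c) : distribFn f τ ≤ c := by
  have hU : {t : ℝ | τ < |f t|} = ⋃ n : ℕ, {t : ℝ | τ + 1 / ((n : ℝ) + 1) < |f t|} := by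
    ext t
    simp only [mem_ofPred_eq, mem_iUnion]
    constructor
    · intro ht
      obtain ⟨n, hn⟩ := exists_nat_one_div_lt (sub_pos.2 ht)
      exact ⟨n, by linarith⟩
    · rintro ⟨n, hn⟩
      have : (0 : ℝ) < 1 / ((n : ℝ) + 1) := by positivity
      linarith
  have hmono : Monotone fun n : ℕ => {t : ℝ | τ + 1 / ((n : ℝ) + 1) < |f t|} := by
    intro m n hmn t ht
    simp only [mem_ofPred_eq] at ht ⊢
    have : 1 / ((n : ℝ) + 1) ≤ 1 / ((m : ℝ) + 1) := by gcongr
    linarith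
  rw [distribFn, hU, hmono.measure_iUnion]
  refine iSup_le fun n => h _ ?_
  have : (0 : ℝ) < 1 / ((n : ℝ) + 1) := by positivity
  linarith

theorem exists_distribFn_le {f : ℝ → ℝ} (hf : Measurable f)
    (hfsupp : (volume.restrict (Set.Ioi (0:ℝ))) {t : ℝ | f t ≠ 0} < ⊤) {s : ℝ} (hs : 0 < s) :
    ∃ τ : ℝ, 0 < τ ∧ distribFn f τ ≤ ENNReal.ofReal s := by
  have hlim := tendsto_measure_iInter_atTop (μ := volume.restrict (Set.Ioi (0:ℝ)))
    (s := fun n : ℕ => {t : ℝ | (n : ℝ) + 1 < |f t|})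
    (fun n => (measurableSet_lt measurable_const hf.abs).nullMeasurableSet)
    (by
      intro m n hmn t ht
      simp only [mem_ofPred_eq] at ht ⊢
      have : (m : ℝ) ≤ n := by exact_mod_cast hmn
      linarith)
    ⟨0, ((distribFn_le_support f (by positivity)).trans_lt hfsupp).ne⟩
  have hempty : ⋂ n : ℕ, {t : ℝ | (n : ℝ) + 1 < |f t|} = ∅ := by
    ext t
    simp only [mem_iInter, mem_ofPred_eq, mem_empty_iff_false, iff_false, not_forall, not_lt]
    obtain ⟨n, hn⟩ := exists_nat_ge |f t|
    exact ⟨n, by linarith⟩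
  rw [hempty, measure_empty] at hlim
  obtain ⟨n, hn⟩ := ((tendsto_order.1 hlim).2 _ (ENNReal.ofReal_pos.2 hs)).exists
  exact ⟨n + 1, by positivity, hn.le⟩

theorem rearr_nonneg (f : ℝ → ℝ) (s : ℝ) : 0 ≤ rearr f s :=
  Real.sInf_nonneg fun _ hτ => hτ.1.le

theorem lt_rearr_iff {f : ℝ → ℝ} (hf : Measurable f)
    (hfsupp : (volume.restrict (Set.Ioi (0:ℝ))) {t : ℝ | f t ≠ 0} < ⊤) {s τ : ℝ} (hs : 0 < s)
    (hτ : 0 < τ) : τ < rearr f s ↔ ENNReal.ofReal s < distribFn f τ := by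
  rw [← not_le, ← not_le, not_iff_not]
  constructor
  · intro h
    refine distribFn_le_of_forall_gt f fun σ hσ => ?_
    obtain ⟨σ', hσ', hlt⟩ := exists_lt_of_csInf_lt (exists_distribFn_le hf hfsupp hs)
      (lt_of_le_of_lt h hσ)
    exact (distribFn_antitone f hlt.le).trans hσ'.2
  · intro h
    exact csInf_le ⟨0, fun _ hx => hx.1.le⟩ ⟨hτ, h⟩

theorem rearr_antitoneOn {f : ℝ → ℝ} (hf : Measurable f)
    (hfsupp : (volume.restrict (Set.Ioi (0:ℝ))) {t : ℝ | f t ≠ 0} < ⊤) :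
    AntitoneOn (rearr f) (Set.Ioi 0) := by
  intro s hs s' _ hss'
  exact csInf_le_csInf ⟨0, fun _ hx => hx.1.le⟩ (exists_distribFn_le hf hfsupp hs)
    fun τ hτ => ⟨hτ.1, hτ.2.trans (ENNReal.ofReal_le_ofReal hss')⟩

theorem lintegral_rpow_sub_one_Ioo {r L : ℝ} (hr : 0 < r) (hL : 0 ≤ L) :
    ∫⁻ t in Set.Ioo 0 L, ENNReal.ofReal (t ^ (r - 1)) = ENNReal.ofReal (L ^ r / r) := by
  have hint : IntervalIntegrable (fun x : ℝ => x ^ (r - 1)) volume 0 L :=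
    intervalIntegral.intervalIntegrable_rpow' (by linarith)
  rw [intervalIntegrable_iff_integrableOn_Ioo_of_le hL] at hint
  rw [← ofReal_integral_eq_lintegral_ofReal hint
    ((ae_restrict_iff' measurableSet_Ioo).2 (ae_of_all _ fun t ht => rpow_nonneg ht.1.le _)),
    ← integral_Ioc_eq_integral_Ioo, ← intervalIntegral.integral_of_le hL,
    integral_rpow (Or.inl (by linarith))]
  simp [hr.ne']

/-- The Lorentz integral of a rearrangement in terms of the distribution function. -/
theorem lintegral_rearr_rpow {f : ℝ → ℝ} (hf : Measurable f)
    (hfsupp : (volume.restrict (Set.Ioi (0:ℝ))) {t : ℝ | f t ≠ 0} < ⊤) {r a : ℝ} (hr : 0 < r)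
    (ha : 0 < a) :
    ∫⁻ t in Set.Ioi (0:ℝ), ENNReal.ofReal (rearr f t ^ a * t ^ (r - 1)) =
      ENNReal.ofReal a * (ENNReal.ofReal r⁻¹ *
        ∫⁻ τ in Set.Ioi (0:ℝ), distribFn f τ ^ r * ENNReal.ofReal (τ ^ (a - 1))) := by
  have hw : Measurable fun t : ℝ => ENNReal.ofReal (t ^ (r - 1)) := by fun_prop
  have hm : AEMeasurable (rearr f) (volume.restrict (Set.Ioi (0:ℝ))) :=
    aemeasurable_restrict_of_antitoneOn measurableSet_Ioi (rearr_antitoneOn hf hfsupp)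
  have hcake := lintegral_rpow_eq_lintegral_meas_lt_mul
    ((volume.restrict (Set.Ioi (0:ℝ))).withDensity fun t => ENNReal.ofReal (t ^ (r - 1)))
    (f := rearr f) (ae_of_all _ (rearr_nonneg f))
    (hm.mono_ac (withDensity_absolutelyContinuous _ _)) ha
  rw [lintegral_withDensity_eq_lintegral_mul₀ hw.aemeasurable (hm.pow_const a).ennreal_ofReal]
    at hcake
  have hleft : ∫⁻ t in Set.Ioi (0:ℝ), ENNReal.ofReal (rearr f t ^ a * t ^ (r - 1)) =
      ∫⁻ t in Set.Ioi (0:ℝ), ((fun t : ℝ => ENNReal.ofReal (t ^ (r - 1))) *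
        fun t => ENNReal.ofReal (rearr f t ^ a)) t := by
    refine lintegral_congr fun t => ?_
    rw [Pi.mul_apply, mul_comm (ENNReal.ofReal _),
      ENNReal.ofReal_mul (rpow_nonneg (rearr_nonneg f t) _)]
  rw [hleft, hcake, ← lintegral_const_mul' (ENNReal.ofReal r⁻¹) _ ENNReal.ofReal_ne_top]
  congr 1
  refine setLIntegral_congr_fun measurableSet_Ioi fun τ hτ => ?_
  have hfin : distribFn f τ ≠ ⊤ :=
    ((distribFn_le_support f (le_of_lt hτ)).trans_lt hfsupp).ne
  have hset : {t : ℝ | τ < rearr f t} ∩ Set.Ioi 0 = Set.Ioo 0 (distribFn f τ).toReal := by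
    ext t
    simp only [mem_inter_iff, mem_ofPred_eq, mem_Ioi, mem_Ioo]
    rw [and_comm]
    refine and_congr_right fun ht => ?_
    rw [lt_rearr_iff hf hfsupp ht hτ, ENNReal.ofReal_lt_iff_lt_toReal ht.le hfin]
  rw [withDensity_apply', Measure.restrict_restrict' measurableSet_Ioi, hset,
    lintegral_rpow_sub_one_Ioo hr ENNReal.toReal_nonneg, div_eq_inv_mul,
    ENNReal.ofReal_mul (inv_nonneg.2 hr.le),
    ← ENNReal.ofReal_rpow_of_nonneg ENNReal.toReal_nonneg hr.le, ENNReal.ofReal_toReal hfin,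
    mul_assoc]

/-- Integration by parts against a power, for nonnegative functions. -/
theorem lintegral_mul_rpow_eq_lintegral_tail {F : ℝ → ℝ≥0∞} (hF : Measurable F) {b : ℝ}
    (hb : 0 < b) :
    ∫⁻ τ in Set.Ioi (0:ℝ), F τ * ENNReal.ofReal (τ ^ b) =
      ENNReal.ofReal b *
        ∫⁻ τ in Set.Ioi (0:ℝ), (∫⁻ s in Set.Ioi τ, F s) * ENNReal.ofReal (τ ^ (b - 1)) := by
  have hcake := lintegral_rpow_eq_lintegral_meas_lt_mul
    ((volume.restrict (Set.Ioi (0:ℝ))).withDensity F) (f := fun τ : ℝ => τ)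
    ((withDensity_absolutelyContinuous _ _).ae_le
      ((ae_restrict_iff' measurableSet_Ioi).2 (ae_of_all _ fun t ht => le_of_lt ht)))
    measurable_id.aemeasurable hb
  rw [lintegral_withDensity_eq_lintegral_mul _ hF (by fun_prop)] at hcake
  refine hcake.trans ?_
  congr 1
  refine setLIntegral_congr_fun measurableSet_Ioi fun τ hτ => ?_
  have hset : {t : ℝ | τ < t} ∩ Set.Ioi 0 = Set.Ioi τ := by
    ext t
    simp only [mem_inter_iff, mem_ofPred_eq, mem_Ioi, and_iff_left_iff_imp]
    exact fun h => lt_trans hτ h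
  rw [withDensity_apply', Measure.restrict_restrict' measurableSet_Ioi, hset]

theorem ENNReal_mul_add_mul_le_mul_add_mul {x y u v : ℝ≥0∞} (hyx : y ≤ x) (huv : u ≤ v) :
    x * u + y * v ≤ x * v + y * u := by
  obtain ⟨d, rfl⟩ := exists_add_of_le hyx
  calc (y + d) * u + y * v = y * u + y * v + d * u := by ring
    _ ≤ y * u + y * v + d * v := by gcongr
    _ = (y + d) * v + y * u := by ring

/-- If two functions cross once at `τ₁` and their moments of order `b` are ordered, then so are
those of any higher order. -/
theorem lintegral_mul_rpow_le_of_crossing {U V : ℝ → ℝ≥0∞} (hU : Measurable U)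
    (hV : Measurable V) {b c τ₁ : ℝ} (hbc : b < c) (hτ₁ : 0 ≤ τ₁)
    (h₁ : ∀ τ, τ₁ ≤ τ → V τ ≤ U τ) (h₂ : ∀ τ, 0 ≤ τ → τ ≤ τ₁ → U τ ≤ V τ)
    (hfin : ∫⁻ τ in Set.Ioi (0:ℝ), U τ * ENNReal.ofReal (τ ^ b) ≠ ⊤)
    (hle : ∫⁻ τ in Set.Ioi (0:ℝ), V τ * ENNReal.ofReal (τ ^ b) ≤
      ∫⁻ τ in Set.Ioi (0:ℝ), U τ * ENNReal.ofReal (τ ^ b)) :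
    ∫⁻ τ in Set.Ioi (0:ℝ), V τ * ENNReal.ofReal (τ ^ c) ≤
      ∫⁻ τ in Set.Ioi (0:ℝ), U τ * ENNReal.ofReal (τ ^ c) := by
  set k : ℝ≥0∞ := ENNReal.ofReal (τ₁ ^ (c - b)) with hk
  have hpt : ∀ τ ∈ Set.Ioi (0:ℝ),
      V τ * ENNReal.ofReal (τ ^ c) + k * (U τ * ENNReal.ofReal (τ ^ b)) ≤
        U τ * ENNReal.ofReal (τ ^ c) + k * (V τ * ENNReal.ofReal (τ ^ b)) := by
    intro τ hτ
    have hτ0 : (0:ℝ) < τ := hτ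
    have hsplit : ENNReal.ofReal (τ ^ c) =
        ENNReal.ofReal (τ ^ (c - b)) * ENNReal.ofReal (τ ^ b) := by
      rw [← ENNReal.ofReal_mul (rpow_nonneg hτ0.le _), ← rpow_add hτ0, sub_add_cancel]
    have key : ENNReal.ofReal (τ ^ (c - b)) * V τ + k * U τ ≤
        ENNReal.ofReal (τ ^ (c - b)) * U τ + k * V τ := by
      rcases le_total τ₁ τ with h | h
      · exact ENNReal_mul_add_mul_le_mul_add_mul
          (ENNReal.ofReal_le_ofReal (rpow_le_rpow hτ₁ h (sub_pos.2 hbc).le)) (h₁ τ h)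
      · exact (add_comm _ _).trans_le ((ENNReal_mul_add_mul_le_mul_add_mul
          (ENNReal.ofReal_le_ofReal (rpow_le_rpow hτ0.le h (sub_pos.2 hbc).le))
          (h₂ τ hτ0.le h)).trans_eq (add_comm _ _))
    rw [hsplit]
    calc _ = (ENNReal.ofReal (τ ^ (c - b)) * V τ + k * U τ) * ENNReal.ofReal (τ ^ b) := by ring
      _ ≤ (ENNReal.ofReal (τ ^ (c - b)) * U τ + k * V τ) * ENNReal.ofReal (τ ^ b) := by gcongr
      _ = _ := by ring
  have hkt : k ≠ ⊤ := ENNReal.ofReal_ne_top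
  have hmain := setLIntegral_mono' (μ := volume) measurableSet_Ioi hpt
  rw [lintegral_add_left (by fun_prop), lintegral_add_left (by fun_prop),
    lintegral_const_mul' _ _ hkt, lintegral_const_mul' _ _ hkt] at hmain
  refine ENNReal.le_of_add_le_add_right (ENNReal.mul_ne_top hkt hfin) (hmain.trans ?_)
  gcongr

/-- For functions supported on a set of finite measure, finiteness of a Lorentz integral passes
to lower exponents. -/
theorem lintegral_distribFn_rpow_ne_top {f : ℝ → ℝ}
    (hfsupp : (volume.restrict (Set.Ioi (0:ℝ))) {t : ℝ | f t ≠ 0} < ⊤) {r b c : ℝ} (hr : 0 < r)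
    (hb : 0 ≤ b) (hbc : b ≤ c)
    (hfin : ∫⁻ τ in Set.Ioi (0:ℝ), distribFn f τ ^ r * ENNReal.ofReal (τ ^ c) ≠ ⊤) :
    ∫⁻ τ in Set.Ioi (0:ℝ), distribFn f τ ^ r * ENNReal.ofReal (τ ^ b) ≠ ⊤ := by
  set M := (volume.restrict (Set.Ioi (0:ℝ))) {t : ℝ | f t ≠ 0}
  have hpt : ∀ τ ∈ Set.Ioi (0:ℝ), distribFn f τ ^ r * ENNReal.ofReal (τ ^ b) ≤
      (Set.Ioc (0:ℝ) 1).indicator (fun _ => M ^ r) τ +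
        distribFn f τ ^ r * ENNReal.ofReal (τ ^ c) := by
    intro τ hτ
    have hτ0 : (0:ℝ) < τ := hτ
    rcases le_total τ 1 with h | h
    · rw [indicator_of_mem (show τ ∈ Set.Ioc (0:ℝ) 1 from ⟨hτ0, h⟩)]
      refine le_add_right ?_
      calc distribFn f τ ^ r * ENNReal.ofReal (τ ^ b) ≤ M ^ r * 1 := by
            gcongr
            · exact distribFn_le_support f hτ0.le
            · exact ENNReal.ofReal_le_one.2 (rpow_le_one hτ0.le h hb)
        _ = M ^ r := mul_one _
    · refine le_add_left ?_
      gcongr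
  refine ((setLIntegral_mono' measurableSet_Ioi hpt).trans_lt ?_).ne
  rw [lintegral_add_left (measurable_const.indicator measurableSet_Ioc)]
  refine ENNReal.add_lt_top.2 ⟨?_, hfin.lt_top⟩
  rw [lintegral_indicator measurableSet_Ioc, lintegral_const]
  refine ENNReal.mul_lt_top (ENNReal.rpow_lt_top_of_nonneg hr.le hfsupp.ne) ?_
  rw [Measure.restrict_restrict measurableSet_Ioc, Measure.restrict_apply_univ]
  exact (measure_mono inter_subset_left).trans_lt measure_Ioc_lt_top

/-- Nazarov–Podkorytov type result for `L(p,q)` under weakened (integrated) crossing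
conditions, for functions with supports of finite measure. -/
theorem statement2 (p₀ p q₀ q : ℝ) (hp₀ : 0 < p₀) (hp : 0 < p)
    (hq₀ : 1 < q₀) (hqq : q₀ < q) (hratio : q / p = q₀ / p₀)
    (f g : ℝ → ℝ) (hf : Measurable f) (hg : Measurable g)
    (hfsupp : (volume.restrict (Set.Ioi (0:ℝ))) {t : ℝ | f t ≠ 0} < ⊤)
    (hgsupp : (volume.restrict (Set.Ioi (0:ℝ))) {t : ℝ | g t ≠ 0} < ⊤)
    (hint₀ : IntegrableOn
      (fun t => (rearr f t ^ q₀ - rearr g t ^ q₀) * t ^ (q₀ / p₀ - 1)) (Set.Ioi 0))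
    (hpos₀ : 0 ≤ (q₀ / p₀) *
      ∫ t in Set.Ioi (0:ℝ), (rearr f t ^ q₀ - rearr g t ^ q₀) * t ^ (q₀ / p₀ - 1))
    (hfL : IntegrableOn (fun s => rearr f s ^ q * s ^ (q / p - 1)) (Set.Ioi 0))
    (hgL : IntegrableOn (fun s => rearr g s ^ q * s ^ (q / p - 1)) (Set.Ioi 0))
    (τ₁ : ℝ) (hτ₁ : 0 ≤ τ₁)
    (htail₁ : ∀ τ : ℝ, τ₁ ≤ τ →
      ∫⁻ s in Set.Ioi τ, (distribFn g s) ^ (q₀ / p₀) ≤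
        ∫⁻ s in Set.Ioi τ, (distribFn f s) ^ (q₀ / p₀))
    (htail₂ : ∀ τ : ℝ, 0 ≤ τ → τ ≤ τ₁ →
      ∫⁻ s in Set.Ioi τ, (distribFn f s) ^ (q₀ / p₀) ≤
        ∫⁻ s in Set.Ioi τ, (distribFn g s) ^ (q₀ / p₀)) :
    ((q / p) * ∫ s in Set.Ioi (0:ℝ), rearr g s ^ q * s ^ (q / p - 1)) ^ (1 / q) ≤
      ((q / p) * ∫ s in Set.Ioi (0:ℝ), rearr f s ^ q * s ^ (q / p - 1)) ^ (1 / q) := by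
  have hr : 0 < q₀ / p₀ := by positivity
  rw [hratio] at hfL hgL ⊢
  generalize q₀ / p₀ = r at *
  have hnonneg : ∀ (h : ℝ → ℝ) (a : ℝ), 0 ≤ᵐ[volume.restrict (Set.Ioi (0:ℝ))]
      fun s => rearr h s ^ a * s ^ (r - 1) := fun h a =>
    (ae_restrict_iff' measurableSet_Ioi).2 (ae_of_all _ fun s hs =>
      mul_nonneg (rpow_nonneg (rearr_nonneg h s) _) (rpow_nonneg (le_of_lt hs) _))
  have hmeas : ∀ (h : ℝ → ℝ) (_ : Measurable h)
      (_ : (volume.restrict (Set.Ioi (0:ℝ))) {t : ℝ | h t ≠ 0} < ⊤) (a : ℝ),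
      AEStronglyMeasurable (fun s => rearr h s ^ a * s ^ (r - 1))
        (volume.restrict (Set.Ioi (0:ℝ))) := fun h hh hs a =>
    (((aemeasurable_restrict_of_antitoneOn measurableSet_Ioi
      (rearr_antitoneOn hh hs)).pow_const a).mul
        (by fun_prop : Measurable fun s : ℝ => s ^ (r - 1)).aemeasurable).aestronglyMeasurable
  have hF : ∀ h : ℝ → ℝ, Measurable fun τ => distribFn h τ ^ r := fun h =>
    (distribFn_antitone h).measurable.pow_const r
  have hT : ∀ h : ℝ → ℝ, Measurable fun τ => ∫⁻ s in Set.Ioi τ, distribFn h s ^ r := fun h =>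
    Antitone.measurable fun _ _ hab => lintegral_mono_set (Ioi_subset_Ioi hab)
  have hlow : ∀ (h : ℝ → ℝ) (_ : Measurable h)
      (_ : (volume.restrict (Set.Ioi (0:ℝ))) {t : ℝ | h t ≠ 0} < ⊤)
      (_ : IntegrableOn (fun s => rearr h s ^ q * s ^ (r - 1)) (Set.Ioi 0)),
      IntegrableOn (fun s => rearr h s ^ q₀ * s ^ (r - 1)) (Set.Ioi 0) := by
    intro h hh hs hL
    refine ⟨hmeas h hh hs q₀, ?_⟩
    have hLfin := ((hasFiniteIntegral_iff_ofReal (hnonneg h q)).1 hL.2).ne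
    rw [hasFiniteIntegral_iff_ofReal (hnonneg h q₀), lintegral_rearr_rpow hh hs hr (by linarith)]
    rw [lintegral_rearr_rpow hh hs hr (by linarith)] at hLfin
    refine (ENNReal.mul_ne_top ENNReal.ofReal_ne_top (ENNReal.mul_ne_top ENNReal.ofReal_ne_top
      (lintegral_distribFn_rpow_ne_top hs hr (c := q - 1) (by linarith) (by linarith)
        fun htop => hLfin ?_))).lt_top
    rw [htop, ENNReal.mul_top (ENNReal.ofReal_pos.2 (inv_pos.2 hr)).ne',
      ENNReal.mul_top (ENNReal.ofReal_pos.2 (by linarith)).ne']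
  have hf₀ := hlow f hf hfsupp hfL
  have hg₀ := hlow g hg hgsupp hgL
  have htails : ∀ (h : ℝ → ℝ) (_ : Measurable h)
      (_ : (volume.restrict (Set.Ioi (0:ℝ))) {t : ℝ | h t ≠ 0} < ⊤) (a : ℝ) (_ : 1 < a),
      ∫⁻ t in Set.Ioi (0:ℝ), ENNReal.ofReal (rearr h t ^ a * t ^ (r - 1)) =
        ENNReal.ofReal (a * r⁻¹ * (a - 1)) * ∫⁻ τ in Set.Ioi (0:ℝ),
          (∫⁻ s in Set.Ioi τ, distribFn h s ^ r) * ENNReal.ofReal (τ ^ (a - 1 - 1)) := by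
    intro h hh hs a ha
    rw [lintegral_rearr_rpow hh hs hr (by linarith),
      lintegral_mul_rpow_eq_lintegral_tail (hF h) (sub_pos.2 ha),
      ENNReal.ofReal_mul (by positivity), ENNReal.ofReal_mul (by positivity), mul_assoc,
      mul_assoc]
  have hconst : ∀ a : ℝ, 1 < a → ENNReal.ofReal (a * r⁻¹ * (a - 1)) ≠ 0 := fun a ha =>
    (ENNReal.ofReal_pos.2
      (mul_pos (mul_pos (by linarith) (inv_pos.2 hr)) (sub_pos.2 ha))).ne'
  have hpos : ∫ t in Set.Ioi (0:ℝ), rearr g t ^ q₀ * t ^ (r - 1) ≤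
      ∫ t in Set.Ioi (0:ℝ), rearr f t ^ q₀ * t ^ (r - 1) := by
    have h0 := nonneg_of_mul_nonneg_right hpos₀ hr
    simp only [sub_mul] at h0
    rw [integral_sub hf₀ hg₀] at h0
    linarith
  have hle₀ : ∫⁻ t in Set.Ioi (0:ℝ), ENNReal.ofReal (rearr g t ^ q₀ * t ^ (r - 1)) ≤
      ∫⁻ t in Set.Ioi (0:ℝ), ENNReal.ofReal (rearr f t ^ q₀ * t ^ (r - 1)) := by
    rw [← ofReal_integral_eq_lintegral_ofReal hg₀ (hnonneg g q₀),
      ← ofReal_integral_eq_lintegral_ofReal hf₀ (hnonneg f q₀)]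
    exact ENNReal.ofReal_le_ofReal hpos
  have hfin₀ := ((hasFiniteIntegral_iff_ofReal (hnonneg f q₀)).1 hf₀.2).ne
  rw [htails g hg hgsupp q₀ hq₀, htails f hf hfsupp q₀ hq₀,
    ENNReal.mul_le_mul_iff_right (hconst q₀ hq₀) ENNReal.ofReal_ne_top] at hle₀
  rw [htails f hf hfsupp q₀ hq₀] at hfin₀
  have hmoments := lintegral_mul_rpow_le_of_crossing (hT f) (hT g)
    (b := q₀ - 1 - 1) (c := q - 1 - 1) (by linarith) hτ₁ htail₁ htail₂
    (fun htop => hfin₀ (by rw [htop, ENNReal.mul_top (hconst q₀ hq₀)])) hle₀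
  have hle : ∫ s in Set.Ioi (0:ℝ), rearr g s ^ q * s ^ (r - 1) ≤
      ∫ s in Set.Ioi (0:ℝ), rearr f s ^ q * s ^ (r - 1) := by
    rw [integral_eq_lintegral_of_nonneg_ae (hnonneg g q) hgL.1,
      integral_eq_lintegral_of_nonneg_ae (hnonneg f q) hfL.1]
    refine ENNReal.toReal_mono ((hasFiniteIntegral_iff_ofReal (hnonneg f q)).1 hfL.2).ne ?_
    rw [htails g hg hgsupp q (by linarith), htails f hf hfsupp q (by linarith)]
    gcongr
  exact rpow_le_rpow (mul_nonneg hr.le (integral_nonneg_of_ae (hnonneg g q)))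
    (mul_le_mul_of_nonneg_left hle hr.le) (one_div_nonneg.2 (by linarith))
end

section
/- For every q ≥ 2 and every 0 < α ≤ 1, one has ∫₀^∞ (h*(t))^{q} t^{α−1} dt ≤ (1/2) q^{−α/2} (2π)^{α/2} Γ(α/2), where h* is the non-increasing rearrangement of the function h(t) = |sin(t)/t| on (0,∞) and Γ is the gamma function. -/
open MeasureTheory Set Real Filter
open scoped ENNReal NNReal

/-- The function `|sin t / t|`. -/
noncomputable def absSinc (t : ℝ) : ℝ := |Real.sin t / t|

/-- The distribution function of the Gaussian `exp (-t² / (2π))` on `(0,∞)`. -/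
noncomputable def gaussDistrib (τ : ℝ) : ℝ := √(-(2 * π) * Real.log τ)

lemma gaussDistrib_nonneg (τ : ℝ) : 0 ≤ gaussDistrib τ := Real.sqrt_nonneg _

lemma lt_exp_iff_lt_gaussDistrib {τ t : ℝ} (hτ : 0 < τ) (ht : 0 ≤ t) :
    τ < Real.exp (-(1 / (2 * π)) * t ^ 2) ↔ t < gaussDistrib τ := by
  rw [gaussDistrib, Real.lt_sqrt ht, ← Real.log_lt_iff_lt_exp hτ]
  have hp : (0:ℝ) < 2 * π := by positivity
  have e : -(1 / (2 * π)) * t ^ 2 = -(t ^ 2 / (2 * π)) := by ring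
  rw [e, lt_neg, div_lt_iff₀ hp]
  constructor <;> intro h <;> linarith

lemma gaussDistrib_pos {τ : ℝ} (h0 : 0 < τ) (h1 : τ < 1) : 0 < gaussDistrib τ := by
  apply Real.sqrt_pos.2
  have := Real.log_neg h0 h1
  have := Real.pi_pos
  nlinarith

lemma gaussDistrib_anti {τ τ' : ℝ} (h0 : 0 < τ) (h : τ ≤ τ') :
    gaussDistrib τ' ≤ gaussDistrib τ := by
  apply Real.sqrt_le_sqrt
  have := Real.log_le_log h0 h
  have := Real.pi_pos
  nlinarith

lemma gaussDistrib_le {τ L : ℝ} (hL : 0 ≤ L) (h : -Real.log τ ≤ L ^ 2 / (2 * π)) :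
    gaussDistrib τ ≤ L := by
  apply Real.sqrt_le_iff.2 ⟨hL, ?_⟩
  rw [le_div_iff₀ (by positivity)] at h
  linarith

lemma abs_sin_sub_mul_cos_le {t : ℝ} (ht : 0 ≤ t) :
    |t * Real.cos t - Real.sin t| ≤ t ^ 2 / 2 := by
  have key : ∀ c : ℝ, |c| ≤ 1 → c * (t * Real.cos t - Real.sin t) ≤ t ^ 2 / 2 := by
    intro c hc
    have hd : ∀ x : ℝ, HasDerivAt (fun x => x ^ 2 / 2 - c * (x * Real.cos x - Real.sin x))
        (x * (1 + c * Real.sin x)) x := by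
      intro x
      refine HasDerivAt.congr_deriv (((hasDerivAt_pow 2 x).div_const 2).sub ((((hasDerivAt_id x).mul
        (Real.hasDerivAt_cos x)).sub (Real.hasDerivAt_sin x)).const_mul c)) ?_
      simp
      ring
    have hm : MonotoneOn (fun x => x ^ 2 / 2 - c * (x * Real.cos x - Real.sin x)) (Ici 0) := by
      apply monotoneOn_of_deriv_nonneg (convex_Ici 0)
      · exact fun x _ => (hd x).continuousAt.continuousWithinAt
      · exact fun x _ => (hd x).differentiableAt.differentiableWithinAt
      · intro x hx
        rw [interior_Ici] at hx
        rw [(hd x).deriv]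
        have : |c * Real.sin x| ≤ 1 := by
          rw [abs_mul]
          exact mul_le_one₀ hc (abs_nonneg _) (Real.abs_sin_le_one x)
        exact mul_nonneg (le_of_lt hx) (by linarith [neg_abs_le (c * Real.sin x)])
    have := hm (mem_Ici.2 le_rfl) (mem_Ici.2 ht) ht
    simp at this
    linarith
  rw [abs_le']
  constructor
  · simpa using key 1 (by simp)
  · simpa using key (-1) (by simp)

lemma hasDerivAt_sin_div {t : ℝ} (ht : 0 < t) :
    HasDerivAt (fun s => Real.sin s / s) ((t * Real.cos t - Real.sin t) / t ^ 2) t := by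
  refine HasDerivAt.congr_deriv ((Real.hasDerivAt_sin t).div (hasDerivAt_id t) ht.ne') ?_
  simp
  ring

lemma lipschitzOnWith_absSinc : LipschitzOnWith (1 / 2) absSinc (Ioi 0) := by
  have h : LipschitzOnWith (1 / 2) (fun s => Real.sin s / s) (Ioi 0) := by
    apply (convex_Ioi (0:ℝ)).lipschitzOnWith_of_nnnorm_hasDerivWithin_le
      (fun x hx => (hasDerivAt_sin_div hx).hasDerivWithinAt)
    intro x hx
    have hx : 0 < x := hx
    rw [← NNReal.coe_le_coe, coe_nnnorm, Real.norm_eq_abs, abs_div, abs_of_pos (pow_pos hx 2),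
      div_le_iff₀ (by positivity)]
    have := abs_sin_sub_mul_cos_le hx.le
    push_cast
    linarith
  have h2 := (LipschitzWith.of_le_add (f := fun x : ℝ => |x|) (fun x y => by
    rw [Real.dist_eq]
    have := abs_sub_abs_le_abs_sub x y
    linarith)).comp_lipschitzOnWith h
  exact (one_mul (1 / 2 : ℝ≥0)) ▸ h2

lemma continuousOn_absSinc : ContinuousOn absSinc (Ioi 0) := lipschitzOnWith_absSinc.continuousOn

lemma measurable_absSinc : Measurable absSinc := by
  unfold absSinc
  fun_prop

lemma absSinc_le_inv {t : ℝ} (ht : 0 < t) : absSinc t ≤ 1 / t := by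
  rw [absSinc, abs_div, abs_of_pos ht]
  gcongr
  exact Real.abs_sin_le_one t

lemma le_volume_inter_preimage_Ioo {a b τ τ' : ℝ} (ha : 0 < a)
    (hsub : Ioo τ τ' ⊆ absSinc '' Ioo a b) :
    ENNReal.ofReal (2 * (τ' - τ)) ≤ volume (Ioo a b ∩ absSinc ⁻¹' Ioo τ τ') := by
  set A := Ioo a b ∩ absSinc ⁻¹' Ioo τ τ'
  have h1 : Ioo τ τ' ⊆ absSinc '' A := by
    intro y hy
    obtain ⟨x, hx, rfl⟩ := hsub hy
    exact ⟨x, ⟨hx, hy⟩, rfl⟩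
  have h2 := (lipschitzOnWith_absSinc.mono (s := A)
    (fun x hx => ha.trans hx.1.1)).hausdorffMeasure_image_le zero_le_one
  rw [hausdorffMeasure_real, ENNReal.rpow_one] at h2
  have h3 : ENNReal.ofReal (τ' - τ) ≤ ((1 / 2 : ℝ≥0) : ℝ≥0∞) * volume A := by
    rw [← Real.volume_Ioo]
    exact (measure_mono h1).trans h2
  calc ENNReal.ofReal (2 * (τ' - τ)) = ENNReal.ofReal 2 * ENNReal.ofReal (τ' - τ) :=
        ENNReal.ofReal_mul zero_le_two
    _ ≤ ENNReal.ofReal 2 * (((1 / 2 : ℝ≥0) : ℝ≥0∞) * volume A) := by gcongr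
    _ = volume A := by
        rw [← mul_assoc, ← ENNReal.ofReal_coe_nnreal, ← ENNReal.ofReal_mul zero_le_two]
        norm_num

lemma sin_div_le_exp {t : ℝ} (h0 : 0 < t) (h1 : t ≤ π) :
    Real.sin t / t ≤ Real.exp (-(1 / (2 * π)) * t ^ 2) := by
  have hc : ∀ x ∈ Icc 0 π, x * Real.cos x - Real.sin x ≤ 0 := by
    intro x hx
    have hd : ∀ x : ℝ, HasDerivAt (fun x => x * Real.cos x - Real.sin x)
        (-(x * Real.sin x)) x := by
      intro x
      refine HasDerivAt.congr_deriv (((hasDerivAt_id x).mul (Real.hasDerivAt_cos x)).sub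
        (Real.hasDerivAt_sin x)) ?_
      simp
    have hm : AntitoneOn (fun x => x * Real.cos x - Real.sin x) (Icc 0 π) := by
      apply antitoneOn_of_deriv_nonpos (convex_Icc 0 π)
      · exact fun x _ => (hd x).continuousAt.continuousWithinAt
      · exact fun x _ => (hd x).differentiableAt.differentiableWithinAt
      · intro x hx
        rw [interior_Icc] at hx
        rw [(hd x).deriv]
        have := mul_nonneg hx.1.le (Real.sin_nonneg_of_nonneg_of_le_pi hx.1.le hx.2.le)
        linarith
    simpa using hm (left_mem_Icc.2 Real.pi_pos.le) hx hx.1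
  have hq : ∀ x ∈ Icc 0 π, x * Real.cos x - Real.sin x + x ^ 2 / 3 * Real.sin x ≤ 0 := by
    intro x hx
    have hd : ∀ x : ℝ, HasDerivAt
        (fun x => x * Real.cos x - Real.sin x + x ^ 2 / 3 * Real.sin x)
        (x / 3 * (x * Real.cos x - Real.sin x)) x := by
      intro x
      refine HasDerivAt.congr_deriv ((((hasDerivAt_id x).mul (Real.hasDerivAt_cos x)).sub
        (Real.hasDerivAt_sin x)).add (((hasDerivAt_pow 2 x).div_const 3).mul
        (Real.hasDerivAt_sin x))) ?_
      simp
      ring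
    have hm : AntitoneOn (fun x => x * Real.cos x - Real.sin x + x ^ 2 / 3 * Real.sin x)
        (Icc 0 π) := by
      apply antitoneOn_of_deriv_nonpos (convex_Icc 0 π)
      · exact fun x _ => (hd x).continuousAt.continuousWithinAt
      · exact fun x _ => (hd x).differentiableAt.differentiableWithinAt
      · intro x hx
        rw [interior_Icc] at hx
        rw [(hd x).deriv]
        have h3 : 0 ≤ x / 3 := by linarith [hx.1]
        exact mul_nonpos_of_nonneg_of_nonpos h3 (hc x ⟨hx.1.le, hx.2.le⟩)
    simpa using hm (left_mem_Icc.2 Real.pi_pos.le) hx hx.1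
  have hanti : AntitoneOn (fun x => Real.sinc x * Real.exp (x ^ 2 / 6)) (Icc 0 π) := by
    have hd : ∀ x ∈ Ioo 0 π, HasDerivAt (fun x => Real.sinc x * Real.exp (x ^ 2 / 6))
        ((x * Real.cos x - Real.sin x + x ^ 2 / 3 * Real.sin x) *
          (Real.exp (x ^ 2 / 6) / x ^ 2)) x := by
      intro x hx
      have h2 := (hasDerivAt_sin_div hx.1).mul (((hasDerivAt_pow 2 x).div_const 6).exp)
      have hev : (fun x => Real.sinc x * Real.exp (x ^ 2 / 6)) =ᶠ[nhds x]
          ((fun s => Real.sin s / s) * fun x => Real.exp (x ^ 2 / 6)) := by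
        filter_upwards [lt_mem_nhds hx.1] with y hy
        simp [Real.sinc_of_ne_zero hy.ne']
      refine HasDerivAt.congr_deriv (h2.congr_of_eventuallyEq hev) ?_
      have := hx.1.ne'
      field_simp
      simp
      ring
    apply antitoneOn_of_deriv_nonpos (convex_Icc 0 π)
    · exact (Real.continuous_sinc.mul (by fun_prop)).continuousOn
    · intro x hx
      rw [interior_Icc] at hx
      exact (hd x hx).differentiableAt.differentiableWithinAt
    · intro x hx
      rw [interior_Icc] at hx
      rw [(hd x hx).deriv]
      exact mul_nonpos_of_nonpos_of_nonneg (hq x ⟨hx.1.le, hx.2.le⟩) (by positivity)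
  have h := hanti (left_mem_Icc.2 Real.pi_pos.le) ⟨h0.le, h1⟩ h0.le
  simp only [Real.sinc_of_ne_zero h0.ne', Real.sinc_zero] at h
  have h6 : Real.sin t / t ≤ Real.exp (-(t ^ 2 / 6)) := by
    rw [Real.exp_neg, ← one_div, le_div_iff₀ (Real.exp_pos _)]
    simpa using h
  refine h6.trans (Real.exp_le_exp.2 ?_)
  have : 1 / (2 * π) ≤ 1 / 6 := by
    apply one_div_le_one_div_of_le <;> linarith [Real.pi_gt_three]
  nlinarith [sq_nonneg t]

lemma distribFn_absSinc (τ : ℝ) :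
    distribFn absSinc τ = volume (absSinc ⁻¹' Ioi τ ∩ Ioi 0) := by
  have : {t : ℝ | τ < |absSinc t|} = absSinc ⁻¹' Ioi τ := by
    ext t
    simp [absSinc]
  rw [distribFn, this, Measure.restrict_apply (measurable_absSinc measurableSet_Ioi)]

lemma half_le_sin {x : ℝ} (hx : x ∈ Icc (π / 6) (5 * π / 6)) : 1 / 2 ≤ Real.sin x := by
  have hp := Real.pi_pos
  have h := strictConcaveOn_sin_Icc.concaveOn.min_le_of_mem_Icc (x := π / 6) (y := 5 * π / 6)
    ⟨by linarith, by linarith⟩ ⟨by linarith, by linarith⟩ hx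
  have h5 : Real.sin (5 * π / 6) = 1 / 2 := by
    rw [show 5 * π / 6 = π - π / 6 by ring, Real.sin_pi_sub, Real.sin_pi_div_six]
  rwa [Real.sin_pi_div_six, h5, min_self] at h

lemma abs_sin_add_nat_mul_pi (x : ℝ) (k : ℕ) : |Real.sin (x + k * π)| = |Real.sin x| := by
  rw [Real.sin_add_nat_mul_pi, abs_mul, abs_pow, abs_neg, abs_one, one_pow, one_mul]

lemma Ioo_subset_preimage_absSinc {τ : ℝ} {k : ℕ} (h : τ * (π * (6 * k + 5)) ≤ 3) :
    Ioo (k * π + π / 6) (k * π + 5 * π / 6) ⊆ absSinc ⁻¹' Ioi τ := by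
  intro t ht
  have hp := Real.pi_pos
  have hk : (0:ℝ) ≤ k * π := by positivity
  have ht0 : 0 < t := by linarith [ht.1]
  have h1 := abs_sin_add_nat_mul_pi (t - k * π) k
  rw [sub_add_cancel] at h1
  have h2 := half_le_sin (x := t - k * π) ⟨by linarith [ht.1], by linarith [ht.2]⟩
  have h3 : 1 / 2 ≤ |Real.sin t| := by rw [h1]; exact h2.trans (le_abs_self _)
  show τ < |Real.sin t / t|
  rw [abs_div, abs_of_pos ht0, lt_div_iff₀ ht0]
  rcases le_or_gt τ 0 with hτ | hτ
  · nlinarith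
  · nlinarith [ht.2]

lemma Ioo_zero_subset_preimage_absSinc {τ : ℝ} (h : τ * (π * 5) ≤ 3) :
    Ioo 0 (π / 6) ⊆ absSinc ⁻¹' Ioi τ := by
  intro t ht
  have hp := Real.pi_pos
  have h1 := Real.mul_le_sin ht.1.le (by linarith [ht.2])
  show τ < |Real.sin t / t|
  rw [abs_div, abs_of_pos ht.1, lt_div_iff₀ ht.1]
  refine lt_of_lt_of_le ?_ (h1.trans (le_abs_self _))
  have : τ < 2 / π := by
    rw [lt_div_iff₀ hp]
    linarith
  exact mul_lt_mul_of_pos_right this ht.1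

lemma le_volume_preimage_absSinc {τ : ℝ} (hτ : 0 < τ) {n : ℕ} (hn : 1 ≤ n)
    (h : τ * (π * (6 * n - 1)) ≤ 3) :
    ENNReal.ofReal (π / 6 + 2 * π * n / 3) ≤
      volume (absSinc ⁻¹' Ioi τ ∩ Ioo 0 (n * π)) := by
  have hp := Real.pi_pos
  have step : ∀ (A B C : Set ℝ) (a b : ℝ), MeasurableSet B → Disjoint A B → A ⊆ C → B ⊆ C →
      0 ≤ a → 0 ≤ b → ENNReal.ofReal a ≤ volume A → ENNReal.ofReal b ≤ volume B →
      ENNReal.ofReal (a + b) ≤ volume C := by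
    intro A B C a b hB hd hA hB' ha hb h1 h2
    rw [ENNReal.ofReal_add ha hb]
    calc _ ≤ volume A + volume B := add_le_add h1 h2
      _ = volume (A ∪ B) := (measure_union hd hB).symm
      _ ≤ _ := measure_mono (union_subset hA hB')
  induction n, hn using Nat.le_induction with
  | base =>
    have h' : τ * (π * 5) ≤ 3 := by
      norm_num at h
      linarith
    have hb := Ioo_subset_preimage_absSinc (τ := τ) (k := 0) (by simpa using h')
    simp only [Nat.cast_zero, zero_mul, zero_add] at hb
    apply step (Ioo 0 (π / 6)) (Ioo (π / 6) (5 * π / 6)) _ _ _ measurableSet_Ioo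
    · rw [Set.disjoint_left]
      intro x hx hx'
      linarith [hx.2, hx'.1]
    · exact subset_inter (Ioo_zero_subset_preimage_absSinc h')
        (Ioo_subset_Ioo le_rfl (by norm_num; linarith))
    · exact subset_inter hb (Ioo_subset_Ioo (by linarith) (by norm_num; linarith))
    · positivity
    · positivity
    · simp
    · rw [Real.volume_Ioo]
      apply ENNReal.ofReal_le_ofReal
      push_cast
      linarith
  | succ n hn ih =>
    push_cast at h
    have ih := ih (by nlinarith [mul_pos hτ hp])
    rw [show π / 6 + 2 * π * ((n + 1 : ℕ) : ℝ) / 3 = (π / 6 + 2 * π * n / 3) + 2 * π / 3 by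
      push_cast; ring]
    have hnp : 0 ≤ n * π := by positivity
    apply step _ (Ioo (n * π + π / 6) (n * π + 5 * π / 6)) _ _ _ measurableSet_Ioo _ _ _ _ _ ih
    · rw [Real.volume_Ioo]
      apply ENNReal.ofReal_le_ofReal
      linarith
    · rw [Set.disjoint_left]
      intro x hx hx'
      linarith [hx.2.2, hx'.1]
    · apply inter_subset_inter_right _ (Ioo_subset_Ioo le_rfl _)
      push_cast
      linarith
    · refine subset_inter (Ioo_subset_preimage_absSinc ?_) (Ioo_subset_Ioo (by linarith) ?_)
      · linarith
      · push_cast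
        linarith
    · positivity
    · positivity

lemma neg_log_le_of_le_mul {τ c : ℝ} (hτ : 0 < τ) (h : 1 ≤ τ * c) :
    -Real.log τ ≤ Real.log c := by
  rw [← Real.log_inv]
  apply Real.log_le_log (by positivity)
  rw [inv_le_iff_one_le_mul₀ hτ]
  linarith

lemma gaussDistrib_le_distribFn_of_le {τ : ℝ} (hτ : 0 < τ) (h : τ * (π * 11) ≤ 3) :
    ENNReal.ofReal (gaussDistrib τ) ≤ distribFn absSinc τ := by
  have hp := Real.pi_pos
  have hp3 := Real.pi_gt_d4
  have hp4 := Real.pi_lt_d4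
  set m : ℕ := ⌊(3 / (τ * π) + 1) / 6⌋₊
  have hτp : 0 < τ * π := by positivity
  have hm1 : (m : ℝ) ≤ (3 / (τ * π) + 1) / 6 := Nat.floor_le (by positivity)
  have hm2 : (3 / (τ * π) + 1) / 6 < m + 1 := Nat.lt_floor_add_one _
  have hm3 : 2 ≤ m := by
    apply Nat.le_floor
    have : 11 ≤ 3 / (τ * π) := by
      rw [le_div_iff₀ hτp]
      linarith
    push_cast
    linarith
  have hm3' : (2:ℝ) ≤ m := by exact_mod_cast hm3
  have a1 : τ * (π * (6 * m - 1)) ≤ 3 := by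
    have : 6 * (m:ℝ) - 1 ≤ 3 / (τ * π) := by linarith
    rw [le_div_iff₀ hτp] at this
    linarith
  have a2 : 3 ≤ τ * (π * (6 * m + 5)) := by
    have : 3 / (τ * π) ≤ 6 * m + 5 := by linarith
    rw [div_le_iff₀ hτp] at this
    linarith
  rw [distribFn_absSinc]
  refine le_trans ?_ ((le_volume_preimage_absSinc hτ (by omega) a1).trans
    (measure_mono (inter_subset_inter_right _ Ioo_subset_Ioi_self)))
  apply ENNReal.ofReal_le_ofReal
  apply gaussDistrib_le (by positivity)
  have hc : 0 < π * (6 * m + 5) / 3 := by positivity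
  have b1 := neg_log_le_of_le_mul (c := π * (6 * m + 5) / 3) hτ (by linarith)
  have b2 := Real.log_le_sub_one_of_pos (x := π * (6 * m + 5) / 3 / 16) (by positivity)
  rw [Real.log_div hc.ne' (by norm_num), show (16:ℝ) = 2 ^ (4:ℕ) by norm_num, Real.log_pow] at b2
  have b3 := Real.log_two_lt_d9
  have e : (π / 6 + 2 * π * m / 3) ^ 2 / (2 * π) = π * (4 * m + 1) ^ 2 / 72 := by
    field_simp
    ring
  rw [e]
  norm_num at b2
  nlinarith

lemma mul_lt_abs_sin_of_mem {t : ℝ} (ht : t ∈ Ioo (5 * π / 4) (5 * π / 3)) :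
    0.16 * t < |Real.sin t| := by
  have hp := Real.pi_pos
  have hp3 := Real.pi_gt_d4
  have hp4 := Real.pi_lt_d4
  have hconc : ConcaveOn ℝ (Icc 0 π) (fun x => Real.sin x + (-0.16 * x)) :=
    strictConcaveOn_sin_Icc.concaveOn.add
      ((LinearMap.mulLeft ℝ (-0.16 : ℝ)).concaveOn (convex_Icc 0 π))
  have h := hconc.min_le_of_mem_Icc (x := π / 4) (y := 2 * π / 3) (z := t - π)
    ⟨by linarith, by linarith⟩ ⟨by linarith, by linarith⟩
    ⟨by linarith [ht.1], by linarith [ht.2]⟩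
  have h3 : Real.sin (2 * π / 3) = √3 / 2 := by
    rw [show 2 * π / 3 = π - π / 3 by ring, Real.sin_pi_sub, Real.sin_pi_div_three]
  simp only [Real.sin_pi_div_four, h3, Real.sin_sub_pi] at h
  have s2 : (1.414:ℝ) < √2 := Real.lt_sqrt_of_sq_lt (by norm_num)
  have s3 : (1.732:ℝ) < √3 := Real.lt_sqrt_of_sq_lt (by norm_num)
  refine lt_of_lt_of_le ?_ (neg_le_abs _)
  have : 0.16 * π < min (√2 / 2 + -0.16 * (π / 4)) (√3 / 2 + -0.16 * (2 * π / 3)) := by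
    apply lt_min <;> linarith
  linarith

lemma gaussDistrib_le_distribFn_of_mem {τ : ℝ} (h : 3 ≤ τ * (π * 11)) (h' : τ ≤ 0.16) :
    ENNReal.ofReal (gaussDistrib τ) ≤ distribFn absSinc τ := by
  have hp := Real.pi_pos
  have hp3 := Real.pi_gt_d4
  have hp4 := Real.pi_lt_d4
  have hτ : 0 < τ := by
    by_contra hc
    nlinarith
  have h5 : τ * (π * 5) ≤ 3 := by nlinarith
  rw [distribFn_absSinc]
  have hb := le_volume_preimage_absSinc (n := 1) hτ le_rfl (by norm_num; linarith)
  have hsub : Ioo (5 * π / 4) (5 * π / 3) ⊆ absSinc ⁻¹' Ioi τ := by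
    intro t ht
    have ht0 : 0 < t := by linarith [ht.1]
    show τ < |Real.sin t / t|
    rw [abs_div, abs_of_pos ht0, lt_div_iff₀ ht0]
    have := mul_lt_abs_sin_of_mem ht
    nlinarith
  have hv : ENNReal.ofReal (5 * π / 4) ≤ volume (absSinc ⁻¹' Ioi τ ∩ Ioi 0) := by
    calc ENNReal.ofReal (5 * π / 4)
        = ENNReal.ofReal (π / 6 + 2 * π * (1 : ℕ) / 3) +
            volume (Ioo (5 * π / 4) (5 * π / 3)) := by
          rw [Real.volume_Ioo, ← ENNReal.ofReal_add (by positivity) (by linarith)]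
          congr 1
          push_cast
          ring
      _ ≤ volume (absSinc ⁻¹' Ioi τ ∩ Ioo 0 ((1 : ℕ) * π)) +
            volume (Ioo (5 * π / 4) (5 * π / 3)) := by gcongr
      _ = volume ((absSinc ⁻¹' Ioi τ ∩ Ioo 0 ((1 : ℕ) * π)) ∪ Ioo (5 * π / 4) (5 * π / 3)) := by
          refine (measure_union ?_ measurableSet_Ioo).symm
          rw [Set.disjoint_left]
          intro x hx hx'
          have := hx.2.2
          norm_num at this
          linarith [hx'.1]
      _ ≤ _ := by
          exact measure_mono (union_subset (inter_subset_inter_right _ Ioo_subset_Ioi_self)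
            (subset_inter hsub fun x hx => lt_trans (by positivity) hx.1))
  refine le_trans (ENNReal.ofReal_le_ofReal (gaussDistrib_le (by positivity) ?_)) hv
  have b1 := neg_log_le_of_le_mul (c := 11 * π / 3) hτ (by linarith)
  have b2 := Real.log_le_sub_one_of_pos (x := (11 * π / 3) ^ 2 / 2 ^ 7) (by positivity)
  rw [Real.log_div (by positivity) (by norm_num), Real.log_pow, Real.log_pow] at b2
  have b3 := Real.log_two_lt_d9
  have e : (5 * π / 4) ^ 2 / (2 * π) = 25 * π / 32 := by
    field_simp
    ring
  rw [e]
  norm_num at b2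
  nlinarith

lemma gaussDistrib_add_mul_le {τ τ' : ℝ} (h1 : 0.16 ≤ τ) (h2 : τ ≤ τ') (h3 : τ' ≤ 0.32) :
    gaussDistrib τ + 6 * τ ≤ gaussDistrib τ' + 6 * τ' := by
  have hp := Real.pi_pos
  have hp3 := Real.pi_gt_d4
  have hp4 := Real.pi_lt_d4
  have hlog : ∀ x ∈ Icc (0.16:ℝ) 0.32, x ^ 2 * -Real.log x ≥ 0.0437 ∧ 0 < -Real.log x := by
    intro x hx
    obtain ⟨hx1, hx2⟩ := hx
    have hx0 : 0 < x := by linarith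
    have a := Real.log_le_sub_one_of_pos (x := x * 2 ^ 2) (by positivity)
    rw [Real.log_mul hx0.ne' (by norm_num), Real.log_pow] at a
    have b := Real.log_two_gt_d9
    norm_num at a
    have c : 2.38 - 4 * x ≤ -Real.log x := by linarith
    refine ⟨?_, by linarith⟩
    have : x ^ 2 * (2.38 - 4 * x) ≥ 0.0437 := by
      nlinarith [mul_nonneg (sub_nonneg.2 hx1) (sub_nonneg.2 hx2),
        mul_nonneg (mul_nonneg (sub_nonneg.2 hx1) (sub_nonneg.2 hx2)) hx0.le]
    have := mul_le_mul_of_nonneg_left c (sq_nonneg x)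
    linarith
  have hd : ∀ x ∈ Icc (0.16:ℝ) 0.32, HasDerivAt (fun x => gaussDistrib x + 6 * x)
      (6 - π / (x * gaussDistrib x)) x := by
    intro x hx
    have hx0 : 0 < x := by linarith [hx.1]
    have hl := (hlog x hx).2
    have hpos : 0 < -(2 * π) * Real.log x := by nlinarith
    have hG : √(-(2 * π) * Real.log x) ≠ 0 := (Real.sqrt_pos.2 hpos).ne'
    refine HasDerivAt.congr_deriv (((((Real.hasDerivAt_log hx0.ne').const_mul _).sqrt hpos.ne').add
      ((hasDerivAt_id x).const_mul 6))) ?_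
    rw [gaussDistrib]
    field_simp
    ring
  have hm : MonotoneOn (fun x => gaussDistrib x + 6 * x) (Icc (0.16:ℝ) 0.32) := by
    apply monotoneOn_of_deriv_nonneg (convex_Icc _ _)
    · exact fun x hx => (hd x hx).continuousAt.continuousWithinAt
    · exact fun x hx => (hd x (interior_subset hx)).differentiableAt.differentiableWithinAt
    · intro x hx
      have hx := interior_subset hx
      rw [(hd x hx).deriv, sub_nonneg]
      have hx0 : 0 < x := by linarith [hx.1]
      have hl := hlog x hx
      have hpos : 0 < -(2 * π) * Real.log x := by nlinarith
      have hxG : π / 6 ≤ x * gaussDistrib x := by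
        apply le_of_sq_le_sq
        · rw [mul_pow, gaussDistrib, Real.sq_sqrt hpos.le]
          nlinarith
        · exact mul_nonneg hx0.le (gaussDistrib_nonneg x)
      rw [div_le_iff₀ (lt_of_lt_of_le (by positivity) hxG)]
      linarith
  exact hm ⟨h1, h2.trans h3⟩ ⟨h1.trans h2, h3⟩ h2

lemma absSinc_pi_div_two : absSinc (π / 2) = 2 / π := by
  rw [absSinc, Real.sin_pi_div_two, abs_of_pos (by positivity)]
  field_simp

lemma absSinc_pi : absSinc π = 0 := by simp [absSinc]

lemma absSinc_two_pi : absSinc (2 * π) = 0 := by simp [absSinc]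

lemma distribFn_absSinc_le_of_forall {τ : ℝ} (hτ : 0 < τ) (h : ∀ t, π ≤ t → absSinc t ≤ τ) :
    distribFn absSinc τ ≤ ENNReal.ofReal (gaussDistrib τ) := by
  rw [distribFn_absSinc]
  calc volume (absSinc ⁻¹' Ioi τ ∩ Ioi 0) ≤ volume (Ioo 0 (gaussDistrib τ)) := by
        apply measure_mono
        rintro t ⟨ht, ht0⟩
        have ht : τ < absSinc t := ht
        have ht0 : 0 < t := ht0
        refine ⟨ht0, ?_⟩
        have htp : t < π := by
          by_contra hc
          linarith [h t (not_lt.1 hc)]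
        rw [← lt_exp_iff_lt_gaussDistrib hτ ht0.le]
        refine ht.trans_le (le_trans (le_of_eq ?_) (sin_div_le_exp ht0 htp.le))
        exact abs_of_nonneg (div_nonneg (Real.sin_nonneg_of_nonneg_of_le_pi ht0.le htp.le) ht0.le)
    _ = _ := by rw [Real.volume_Ioo, sub_zero]

lemma distribFn_absSinc_add_le {τ τ' s : ℝ} (h0 : 0 ≤ τ) (h : τ ≤ τ') (hs : s ∈ Ioo π (2 * π))
    (hτ' : τ' ≤ absSinc s) :
    distribFn absSinc τ' + ENNReal.ofReal (6 * (τ' - τ)) ≤ distribFn absSinc τ := by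
  have hp := Real.pi_pos
  have hp4 := Real.pi_lt_d4
  have hcont : ∀ a b : ℝ, 0 < a → ContinuousOn absSinc (Icc a b) := fun a b ha =>
    continuousOn_absSinc.mono fun x hx => lt_of_lt_of_le ha hx.1
  have hs' : absSinc s ≤ 2 / π := by
    refine (absSinc_le_inv (hp.trans hs.1)).trans ?_
    rw [div_le_div_iff₀ (hp.trans hs.1) hp]
    linarith [hs.1]
  have v1 := le_volume_inter_preimage_Ioo (a := π / 2) (b := π) (τ := τ) (τ' := τ')
    (by positivity) ((Ioo_subset_Ioo (by rw [absSinc_pi]; exact h0)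
      (by rw [absSinc_pi_div_two]; linarith)).trans
      (intermediate_value_Ioo' (by linarith) (hcont _ _ (by positivity))))
  have v2 := le_volume_inter_preimage_Ioo (a := π) (b := s) (τ := τ) (τ' := τ') hp
    ((Ioo_subset_Ioo (by rw [absSinc_pi]; exact h0) hτ').trans
      (intermediate_value_Ioo hs.1.le (hcont _ _ hp)))
  have v3 := le_volume_inter_preimage_Ioo (a := s) (b := 2 * π) (τ := τ) (τ' := τ')
    (hp.trans hs.1) ((Ioo_subset_Ioo (by rw [absSinc_two_pi]; exact h0) hτ').trans
      (intermediate_value_Ioo' hs.2.le (hcont _ _ (hp.trans hs.1))))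
  have hmeas : ∀ a b : ℝ, MeasurableSet (Ioo a b ∩ absSinc ⁻¹' Ioo τ τ') := fun a b =>
    measurableSet_Ioo.inter (measurable_absSinc measurableSet_Ioo)
  rw [distribFn_absSinc, distribFn_absSinc,
    show 6 * (τ' - τ) = 2 * (τ' - τ) + 2 * (τ' - τ) + 2 * (τ' - τ) by ring,
    ENNReal.ofReal_add (by linarith) (by linarith), ENNReal.ofReal_add (by linarith) (by linarith)]
  calc _ ≤ volume (absSinc ⁻¹' Ioi τ' ∩ Ioi 0) + (volume (Ioo (π / 2) π ∩ absSinc ⁻¹' Ioo τ τ') +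
        volume (Ioo π s ∩ absSinc ⁻¹' Ioo τ τ') +
        volume (Ioo s (2 * π) ∩ absSinc ⁻¹' Ioo τ τ')) := by gcongr
    _ = volume ((absSinc ⁻¹' Ioi τ' ∩ Ioi 0) ∪ ((Ioo (π / 2) π ∩ absSinc ⁻¹' Ioo τ τ') ∪
        (Ioo π s ∩ absSinc ⁻¹' Ioo τ τ') ∪ (Ioo s (2 * π) ∩ absSinc ⁻¹' Ioo τ τ'))) := by
      rw [measure_union _ (((hmeas _ _).union (hmeas _ _)).union (hmeas _ _)),
        measure_union _ (hmeas _ _), measure_union _ (hmeas _ _)]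
      · rw [Set.disjoint_left]
        exact fun x hx hx' => lt_asymm hx.1.2 hx'.1.1
      · rw [Set.disjoint_left]
        rintro x (hx | hx) hx'
        · exact lt_asymm (hx.1.2.trans hs.1) hx'.1.1
        · exact lt_asymm hx.1.2 hx'.1.1
      · rw [Set.disjoint_left]
        rintro x hx ((hx' | hx') | hx') <;> exact lt_asymm hx.1 hx'.2.2
    _ ≤ _ := by
      apply measure_mono
      rintro x (hx | ((hx | hx) | hx))
      · exact ⟨lt_of_le_of_lt h hx.1, hx.2⟩
      · exact ⟨hx.2.1, lt_trans (by positivity) hx.1.1⟩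
      · exact ⟨hx.2.1, hp.trans hx.1.1⟩
      · exact ⟨hx.2.1, (hp.trans hs.1).trans hx.1.1⟩

/-- The distribution functions of the Gaussian and of `|sin t / t|` cross exactly once. -/
lemma exists_crossing : ∃ τ₀ : ℝ, 0 < τ₀ ∧ τ₀ < 1 ∧
    (∀ τ, 0 < τ → τ < τ₀ → ENNReal.ofReal (gaussDistrib τ) ≤ distribFn absSinc τ) ∧
    (∀ τ, τ₀ < τ → distribFn absSinc τ ≤ ENNReal.ofReal (gaussDistrib τ)) := by
  have hp := Real.pi_pos
  have hp3 := Real.pi_gt_d4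
  have hp4 := Real.pi_lt_d4
  obtain ⟨s, hs, hmax⟩ := (isCompact_Icc (a := π) (b := 2 * π)).exists_isMaxOn
    ⟨π, le_rfl, by linarith⟩ (continuousOn_absSinc.mono fun x hx => lt_of_lt_of_le hp hx.1)
  have hM : 0.16 < absSinc s := by
    refine lt_of_lt_of_le ?_ (hmax (show 3 * π / 2 ∈ Icc π (2 * π) from
      ⟨by linarith, by linarith⟩))
    have := mul_lt_abs_sin_of_mem (t := 3 * π / 2) ⟨by linarith, by linarith⟩
    show _ < |_|
    rwa [abs_div, abs_of_pos (by positivity : 0 < 3 * π / 2), lt_div_iff₀ (by positivity)]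
  have hM' : absSinc s ≤ 0.32 := by
    refine (absSinc_le_inv (hp.trans_le hs.1)).trans ?_
    rw [div_le_iff₀ (hp.trans_le hs.1)]
    linarith [hs.1]
  have hs' : s ∈ Ioo π (2 * π) := by
    refine ⟨lt_of_le_of_ne hs.1 ?_, lt_of_le_of_ne hs.2 ?_⟩
    · rintro rfl
      rw [absSinc_pi] at hM
      norm_num at hM
    · rintro rfl
      rw [absSinc_two_pi] at hM
      norm_num at hM
  have hlarge : ∀ τ, absSinc s ≤ τ →
      distribFn absSinc τ ≤ ENNReal.ofReal (gaussDistrib τ) := by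
    intro τ hτ
    apply distribFn_absSinc_le_of_forall (by linarith)
    intro t ht
    rcases le_or_gt t (2 * π) with h | h
    · exact (hmax ⟨ht, h⟩).trans hτ
    · refine (absSinc_le_inv (hp.trans_le ht)).trans ?_
      rw [div_le_iff₀ (hp.trans_le ht)]
      nlinarith
  have hsmall : ∀ τ, 0 < τ → τ ≤ 0.16 →
      ENNReal.ofReal (gaussDistrib τ) ≤ distribFn absSinc τ := by
    intro τ h0 h
    rcases le_total (τ * (π * 11)) 3 with h1 | h1
    · exact gaussDistrib_le_distribFn_of_le h0 h1
    · exact gaussDistrib_le_distribFn_of_mem h1 h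
  set S : Set ℝ := {τ | τ ∈ Ico 0.16 (absSinc s) ∧
    ENNReal.ofReal (gaussDistrib τ) ≤ distribFn absSinc τ}
  have hmem : 0.16 ∈ S := ⟨⟨le_rfl, hM⟩, hsmall _ (by norm_num) le_rfl⟩
  have hbdd : BddAbove S := ⟨absSinc s, fun x hx => hx.1.2.le⟩
  have hle : sSup S ≤ absSinc s := csSup_le ⟨_, hmem⟩ fun x hx => hx.1.2.le
  have hge : 0.16 ≤ sSup S := le_csSup hbdd hmem
  refine ⟨sSup S, by linarith, by linarith, ?_, ?_⟩
  · intro τ h0 h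
    rcases le_or_gt τ 0.16 with h1 | h1
    · exact hsmall τ h0 h1
    obtain ⟨τ', hτ', hlt⟩ := exists_lt_of_lt_csSup ⟨_, hmem⟩ h
    refine le_trans ?_ (distribFn_absSinc_add_le h0.le hlt.le hs' hτ'.1.2.le)
    calc ENNReal.ofReal (gaussDistrib τ)
        ≤ ENNReal.ofReal (gaussDistrib τ' + 6 * (τ' - τ)) := by
          apply ENNReal.ofReal_le_ofReal
          linarith [gaussDistrib_add_mul_le h1.le hlt.le (hτ'.1.2.le.trans hM')]
      _ = ENNReal.ofReal (gaussDistrib τ') + ENNReal.ofReal (6 * (τ' - τ)) :=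
          ENNReal.ofReal_add (gaussDistrib_nonneg _) (by linarith)
      _ ≤ _ := by gcongr; exact hτ'.2
  · intro τ h
    rcases le_or_gt (absSinc s) τ with h1 | h1
    · exact hlarge τ h1
    by_contra hc
    exact h.not_ge (le_csSup hbdd ⟨⟨by linarith, h1⟩, (not_le.1 hc).le⟩)

lemma lintegral_Ioi_of_hasDerivAt_of_nonneg {g g' : ℝ → ℝ} {a l : ℝ}
    (hderiv : ∀ x ∈ Ici a, HasDerivAt g (g' x) x) (hpos : ∀ x ∈ Ioi a, 0 ≤ g' x)
    (hl : Tendsto g atTop (nhds l)) :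
    ∫⁻ x in Ioi a, ENNReal.ofReal (g' x) = ENNReal.ofReal (l - g a) := by
  rw [← integral_Ioi_of_hasDerivAt_of_nonneg' hderiv hpos hl,
    ofReal_integral_eq_lintegral_ofReal (integrableOn_Ioi_deriv_of_nonneg' hderiv hpos hl)]
  exact (ae_restrict_iff' measurableSet_Ioi).2 (ae_of_all _ hpos)

lemma lintegral_eq_of_integral_eq {f : ℝ → ℝ} {c : ℝ} (hpos : ∀ x ∈ Ioi (0:ℝ), 0 ≤ f x)
    (hc : c ≠ 0) (h : ∫ x in Ioi (0:ℝ), f x = c) :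
    ∫⁻ x in Ioi (0:ℝ), ENNReal.ofReal (f x) = ENNReal.ofReal c := by
  rw [← h, ofReal_integral_eq_lintegral_ofReal]
  · exact Integrable.of_integral_ne_zero (h ▸ hc)
  · exact (ae_restrict_iff' measurableSet_Ioi).2 (ae_of_all _ hpos)

lemma lintegral_mul_exp_neg_mul {t : ℝ} (ht : 0 < t) :
    ∫⁻ s in Ioi (0:ℝ), ENNReal.ofReal (s * Real.exp (-(t * s))) = ENNReal.ofReal (1 / t ^ 2) := by
  apply lintegral_eq_of_integral_eq
  · exact fun s hs => mul_nonneg (le_of_lt hs) (Real.exp_pos _).le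
  · positivity
  · have h := Real.integral_rpow_mul_exp_neg_mul_Ioi (a := 2) two_pos ht
    norm_num at h
    rw [h]
    simp

lemma lintegral_mul_exp_neg_mul_mul_sin_sq {s : ℝ} (hs : 0 < s) :
    ∫⁻ t in Ioi (0:ℝ), ENNReal.ofReal (s * Real.exp (-(t * s)) * Real.sin t ^ 2) =
      ENNReal.ofReal (2 / (s ^ 2 + 4)) := by
  have hs4 : s ^ 2 + 4 ≠ 0 := by positivity
  have hd : ∀ t ∈ Ici (0:ℝ), HasDerivAt (fun t => Real.exp (-(t * s)) *
      (-(1 / 2) + s * (s * Real.cos (2 * t) - 2 * Real.sin (2 * t)) / (2 * (s ^ 2 + 4))))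
      (s * Real.exp (-(t * s)) * Real.sin t ^ 2) t := by
    intro t _
    have h2 : HasDerivAt (fun t : ℝ => 2 * t) 2 t := by
      simpa using (hasDerivAt_id t).const_mul (2:ℝ)
    refine HasDerivAt.congr_deriv ((((hasDerivAt_id t).mul_const s).neg.exp).mul
      ((((((h2.cos).const_mul s).sub ((h2.sin).const_mul 2)).const_mul s).div_const _).const_add
        _)) ?_
    have hsin : Real.sin t ^ 2 = 1 / 2 - Real.cos (2 * t) / 2 := by
      rw [Real.cos_two_mul, ← Real.sin_sq_add_cos_sq t]
      ring
    simp only [id, Pi.neg_apply]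
    rw [hsin]
    field_simp
    ring
  have hbdd : Tendsto (fun t => Real.exp (-(t * s)) *
      (-(1 / 2) + s * (s * Real.cos (2 * t) - 2 * Real.sin (2 * t)) / (2 * (s ^ 2 + 4))))
      atTop (nhds 0) := by
    have he : Tendsto (fun t => Real.exp (-(t * s))) atTop (nhds 0) :=
      Real.tendsto_exp_neg_atTop_nhds_zero.comp (tendsto_id.atTop_mul_const hs)
    refine he.zero_mul_isBoundedUnder_le ⟨1 / 2 + s * (s + 2) / (2 * (s ^ 2 + 4)), ?_⟩
    rw [eventually_map]
    refine Eventually.of_forall fun t => ?_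
    simp only [Function.comp, Real.norm_eq_abs]
    have hc : |s * Real.cos (2 * t) - 2 * Real.sin (2 * t)| ≤ s + 2 := by
      have h1 := Real.cos_le_one (2 * t)
      have h2 := Real.neg_one_le_cos (2 * t)
      have h3 := Real.sin_le_one (2 * t)
      have h4 := Real.neg_one_le_sin (2 * t)
      rw [abs_le]
      constructor <;> nlinarith
    refine (abs_add_le _ _).trans (add_le_add (by norm_num) ?_)
    rw [abs_div, abs_mul, abs_of_pos hs, abs_of_pos (by positivity : 0 < 2 * (s ^ 2 + 4))]
    gcongr
  rw [lintegral_Ioi_of_hasDerivAt_of_nonneg hd (fun t _ => by positivity) hbdd]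
  congr 1
  simp
  field_simp
  ring

lemma lintegral_two_div_sq_add_four :
    ∫⁻ s in Ioi (0:ℝ), ENNReal.ofReal (2 / (s ^ 2 + 4)) = ENNReal.ofReal (π / 2) := by
  have hd : ∀ s ∈ Ici (0:ℝ), HasDerivAt (fun s => Real.arctan (s / 2)) (2 / (s ^ 2 + 4)) s := by
    intro s _
    refine HasDerivAt.congr_deriv (((hasDerivAt_id s).div_const 2).arctan) ?_
    simp only [id]
    field_simp
    ring
  have hl : Tendsto (fun s : ℝ => Real.arctan (s / 2)) atTop (nhds (π / 2)) :=
    (tendsto_nhds_of_tendsto_nhdsWithin Real.tendsto_arctan_atTop).comp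
      (tendsto_id.atTop_div_const two_pos)
  rw [lintegral_Ioi_of_hasDerivAt_of_nonneg hd (fun t _ => by positivity) hl]
  simp

lemma lintegral_absSinc_sq :
    ∫⁻ t in Ioi (0:ℝ), ENNReal.ofReal (absSinc t ^ 2) = ENNReal.ofReal (π / 2) := by
  calc ∫⁻ t in Ioi (0:ℝ), ENNReal.ofReal (absSinc t ^ 2)
      = ∫⁻ t in Ioi (0:ℝ), ∫⁻ s in Ioi (0:ℝ),
          ENNReal.ofReal (s * Real.exp (-(t * s)) * Real.sin t ^ 2) := by
        refine setLIntegral_congr_fun measurableSet_Ioi fun t ht => ?_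
        simp only [ENNReal.ofReal_mul' (sq_nonneg (Real.sin t))]
        rw [lintegral_mul_const _ (by fun_prop), lintegral_mul_exp_neg_mul ht,
          ← ENNReal.ofReal_mul (by positivity), absSinc, sq_abs]
        congr 1
        ring
    _ = ∫⁻ s in Ioi (0:ℝ), ∫⁻ t in Ioi (0:ℝ),
          ENNReal.ofReal (s * Real.exp (-(t * s)) * Real.sin t ^ 2) := by
        apply lintegral_lintegral_swap
        apply Measurable.aemeasurable
        unfold Function.uncurry
        fun_prop
    _ = ∫⁻ s in Ioi (0:ℝ), ENNReal.ofReal (2 / (s ^ 2 + 4)) :=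
        setLIntegral_congr_fun measurableSet_Ioi fun s hs =>
          lintegral_mul_exp_neg_mul_mul_sin_sq hs
    _ = _ := lintegral_two_div_sq_add_four

lemma lintegral_rpow_mul_rpow_eq_lintegral_meas_lt {f : ℝ → ℝ} (hf : Measurable f)
    (hf0 : ∀ t, 0 ≤ f t) {q : ℝ} (hq : 0 < q) (α : ℝ) :
    ∫⁻ t in Ioi (0:ℝ), ENNReal.ofReal (f t ^ q * t ^ (α - 1)) =
      ENNReal.ofReal q * ∫⁻ τ in Ioi (0:ℝ),
        (∫⁻ t in f ⁻¹' Ioi τ ∩ Ioi 0, ENNReal.ofReal (t ^ (α - 1))) *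
          ENNReal.ofReal (τ ^ (q - 1)) := by
  have hm : Measurable fun t : ℝ => ENNReal.ofReal (t ^ (α - 1)) := by fun_prop
  have h := lintegral_rpow_eq_lintegral_meas_lt_mul
    ((volume.restrict (Ioi (0:ℝ))).withDensity fun t => ENNReal.ofReal (t ^ (α - 1)))
    (ae_of_all _ hf0) hf.aemeasurable hq
  rw [lintegral_withDensity_eq_lintegral_mul _ hm (by fun_prop)] at h
  calc _ = _ := by
        refine lintegral_congr fun t => ?_
        rw [Pi.mul_apply, mul_comm, ENNReal.ofReal_mul' (Real.rpow_nonneg (hf0 t) q)]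
    _ = _ := h
    _ = _ := by
        congr 1
        refine lintegral_congr fun τ => ?_
        congr 1
        have hs : MeasurableSet {a | τ < f a} := hf measurableSet_Ioi
        rw [withDensity_apply _ hs, Measure.restrict_restrict hs]
        rfl

lemma lintegral_Ioo_rpow {α L : ℝ} (hα : 0 < α) (hL : 0 ≤ L) :
    ∫⁻ t in Ioo 0 L, ENNReal.ofReal (t ^ (α - 1)) = ENNReal.ofReal (L ^ α / α) := by
  rw [restrict_Ioo_eq_restrict_Ioc]
  have hi : IntervalIntegrable (fun t : ℝ => t ^ (α - 1)) volume 0 L :=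
    intervalIntegral.intervalIntegrable_rpow' (by linarith)
  rw [← ofReal_integral_eq_lintegral_ofReal, ← intervalIntegral.integral_of_le hL,
    integral_rpow (Or.inl (by linarith))]
  · simp [hα.ne']
  · exact (intervalIntegrable_iff_integrableOn_Ioc_of_le hL).1 hi
  · exact (ae_restrict_iff' measurableSet_Ioc).2
      (ae_of_all _ fun t ht => Real.rpow_nonneg ht.1.le _)

lemma lintegral_gauss_rpow {q α : ℝ} (hq : 0 < q) (hα : 0 < α) :
    ∫⁻ t in Ioi (0:ℝ), ENNReal.ofReal (Real.exp (-(1 / (2 * π)) * t ^ 2) ^ q * t ^ (α - 1)) =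
      ENNReal.ofReal ((1 / 2) * q ^ (-α / 2) * (2 * π) ^ (α / 2) * Real.Gamma (α / 2)) := by
  have hp := Real.pi_pos
  apply lintegral_eq_of_integral_eq
  · exact fun t ht => mul_nonneg (Real.rpow_nonneg (Real.exp_pos _).le _)
      (Real.rpow_nonneg (le_of_lt ht) _)
  · have := Real.Gamma_pos_of_pos (half_pos hα)
    positivity
  · have h := integral_rpow_mul_exp_neg_mul_rpow (p := 2) (q := α - 1) (b := q / (2 * π)) two_pos
      (by linarith) (by positivity)
    rw [sub_add_cancel, Real.div_rpow hq.le (by positivity), neg_div,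
      Real.rpow_neg (by positivity : 0 ≤ 2 * π), div_inv_eq_mul] at h
    rw [show (1 / 2) * q ^ (-α / 2) * (2 * π) ^ (α / 2) * Real.Gamma (α / 2) =
      q ^ (-(α / 2)) * (2 * π) ^ (α / 2) * (1 / 2) * Real.Gamma (α / 2) by rw [neg_div]; ring, ← h]
    refine setIntegral_congr_fun measurableSet_Ioi fun t _ => ?_
    rw [← Real.exp_mul, mul_comm]
    congr 2
    rw [Real.rpow_two]
    ring

lemma gaussDistrib_of_one_le {τ : ℝ} (h : 1 ≤ τ) : gaussDistrib τ = 0 := by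
  apply Real.sqrt_eq_zero_of_nonpos
  have := Real.log_nonneg h
  have := Real.pi_pos
  nlinarith

lemma measurable_gaussDistrib : Measurable gaussDistrib := by
  unfold gaussDistrib
  fun_prop

lemma distribFn_absSinc_anti : Antitone (distribFn absSinc) := fun _ _ h =>
  measure_mono fun _ ht => lt_of_le_of_lt h ht

lemma distribFn_absSinc_ne_top {τ : ℝ} (hτ : 0 < τ) : distribFn absSinc τ ≠ ∞ := by
  rw [distribFn_absSinc]
  refine ne_top_of_le_ne_top (b := volume (Ioo 0 (1 / τ))) (by simp) (measure_mono ?_)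
  rintro t ⟨ht, ht0⟩
  have ht0 : 0 < t := ht0
  refine ⟨ht0, ?_⟩
  have := lt_of_lt_of_le ht (absSinc_le_inv ht0)
  rw [lt_div_iff₀ ht0] at this
  rw [lt_div_iff₀ hτ]
  linarith

lemma rpow_le_rpow_add_mul {x y α : ℝ} (hx : 0 ≤ x) (hy : 0 < y) (h0 : 0 ≤ α) (h1 : α ≤ 1) :
    x ^ α ≤ y ^ α + α * y ^ (α - 1) * (x - y) := by
  have h := rpow_one_add_le_one_add_mul_self (s := x / y - 1)
    (by linarith [div_nonneg hx hy.le]) h0 h1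
  rw [add_sub_cancel, Real.div_rpow hx hy.le, div_le_iff₀ (Real.rpow_pos_of_pos hy _)] at h
  rw [Real.rpow_sub_one hy.ne']
  refine h.trans (le_of_eq ?_)
  field_simp

/-- The comparison behind the one-crossing argument: `y ↦ y ^ α` is concave, and the weight
`τ ^ (q - 2) * G ^ (α - 1)` is larger past the crossing than before it. -/
lemma rpow_mul_rpow_add_le {q α τ τ₀ x G G₀ : ℝ} (hq : 2 ≤ q) (hα0 : 0 < α) (hα1 : α ≤ 1)
    (hτ : 0 < τ) (hτ₀ : 0 < τ₀) (hx : 0 ≤ x) (hG : 0 < G) (hG₀ : 0 < G₀)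
    (hlt : τ < τ₀ → G ≤ x ∧ G₀ ≤ G) (hgt : τ₀ < τ → x ≤ G ∧ G ≤ G₀) (heq : τ = τ₀ → G = G₀) :
    x ^ α / α * τ ^ (q - 1) + G₀ ^ (α - 1) * τ₀ ^ (q - 2) * (G * τ) ≤
      G ^ α / α * τ ^ (q - 1) + G₀ ^ (α - 1) * τ₀ ^ (q - 2) * (x * τ) := by
  have hc := rpow_le_rpow_add_mul hx hG hα0.le hα1
  have hc' : x ^ α / α ≤ G ^ α / α + G ^ (α - 1) * (x - G) := by
    rw [div_le_iff₀ hα0, add_mul, div_mul_cancel₀ _ hα0.ne']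
    linarith
  have hτq : τ ^ (q - 1) = τ ^ (q - 2) * τ := by
    rw [← Real.rpow_add_one hτ.ne']
    ring_nf
  have hw : (G ^ (α - 1) * τ ^ (q - 2) - G₀ ^ (α - 1) * τ₀ ^ (q - 2)) * (x - G) ≤ 0 := by
    rcases lt_trichotomy τ τ₀ with h | h | h
    · obtain ⟨h1, h2⟩ := hlt h
      have := mul_le_mul (Real.rpow_le_rpow_of_nonpos hG₀ h2 (by linarith : α - 1 ≤ 0))
        (Real.rpow_le_rpow hτ.le h.le (by linarith : 0 ≤ q - 2)) (by positivity) (by positivity)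
      exact mul_nonpos_of_nonpos_of_nonneg (by linarith) (by linarith)
    · rw [heq h, h, sub_self, zero_mul]
    · obtain ⟨h1, h2⟩ := hgt h
      have := mul_le_mul (Real.rpow_le_rpow_of_nonpos hG h2 (by linarith : α - 1 ≤ 0))
        (Real.rpow_le_rpow hτ₀.le h.le (by linarith : 0 ≤ q - 2)) (by positivity) (by positivity)
      exact mul_nonpos_of_nonneg_of_nonpos (by linarith) (by linarith)
  have h1 := mul_le_mul_of_nonneg_right hc' (by positivity : 0 ≤ τ ^ (q - 1))
  have h2 := mul_le_mul_of_nonneg_right hw hτ.le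
  rw [hτq] at h1 ⊢
  nlinarith

lemma distribFn_absSinc_of_one_le {τ : ℝ} (h : 1 ≤ τ) : distribFn absSinc τ = 0 := by
  obtain ⟨τ₀, -, h1, -, hgt⟩ := exists_crossing
  have := hgt τ (h1.trans_le h)
  rw [gaussDistrib_of_one_le h, ENNReal.ofReal_zero] at this
  exact le_antisymm this zero_le

lemma rearr_absSinc_nonneg (s : ℝ) : 0 ≤ rearr absSinc s :=
  Real.sInf_nonneg fun _ h => h.1.le

lemma antitone_rearr_absSinc : Antitone (rearr absSinc) := fun _ _ h =>
  csInf_le_csInf ⟨0, fun _ hx => hx.1.le⟩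
    ⟨1, one_pos, by rw [distribFn_absSinc_of_one_le le_rfl]; exact zero_le⟩
    fun _ hx => ⟨hx.1, hx.2.trans (ENNReal.ofReal_le_ofReal h)⟩

lemma rearr_absSinc_preimage_subset {τ : ℝ} (hτ : 0 < τ) :
    rearr absSinc ⁻¹' Ioi τ ∩ Ioi 0 ⊆ Ioo 0 (distribFn absSinc τ).toReal := by
  rintro s ⟨hs, hs0⟩
  have hs : τ < rearr absSinc s := hs
  refine ⟨hs0, ?_⟩
  rw [← ENNReal.ofReal_lt_iff_lt_toReal (le_of_lt hs0) (distribFn_absSinc_ne_top hτ)]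
  by_contra hc
  exact hs.not_ge (csInf_le ⟨0, fun _ hx => hx.1.le⟩ ⟨hτ, not_lt.1 hc⟩)

lemma lintegral_gauss_eq {q α : ℝ} (hq : 0 < q) (hα : 0 < α) :
    ENNReal.ofReal ((1 / 2) * q ^ (-α / 2) * (2 * π) ^ (α / 2) * Real.Gamma (α / 2)) =
      ENNReal.ofReal q * ∫⁻ τ in Ioi (0:ℝ),
        ENNReal.ofReal (gaussDistrib τ ^ α / α * τ ^ (q - 1)) := by
  rw [← lintegral_gauss_rpow hq hα, lintegral_rpow_mul_rpow_eq_lintegral_meas_lt (by fun_prop)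
    (fun t => (Real.exp_pos _).le) hq]
  congr 1
  refine setLIntegral_congr_fun measurableSet_Ioi fun τ hτ => ?_
  have hset : (fun t => Real.exp (-(1 / (2 * π)) * t ^ 2)) ⁻¹' Ioi τ ∩ Ioi 0 =
      Ioo 0 (gaussDistrib τ) := by
    ext t
    constructor
    · rintro ⟨h, h0⟩
      exact ⟨h0, (lt_exp_iff_lt_gaussDistrib hτ (le_of_lt h0)).1 h⟩
    · rintro ⟨h0, h⟩
      exact ⟨(lt_exp_iff_lt_gaussDistrib hτ (le_of_lt h0)).2 h, h0⟩
  simp only [hset]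
  have hG := gaussDistrib_nonneg τ
  rw [lintegral_Ioo_rpow hα hG, ENNReal.ofReal_mul (by positivity)]

lemma lintegral_distribFn_absSinc_eq :
    ∫⁻ τ in Ioi (0:ℝ), ENNReal.ofReal ((distribFn absSinc τ).toReal * τ) =
      ∫⁻ τ in Ioi (0:ℝ), ENNReal.ofReal (gaussDistrib τ * τ) ∧
    ∫⁻ τ in Ioi (0:ℝ), ENNReal.ofReal (gaussDistrib τ * τ) ≠ ∞ := by
  have hp := Real.pi_pos
  have h1 := lintegral_rpow_mul_rpow_eq_lintegral_meas_lt measurable_absSinc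
    (fun t => abs_nonneg _) two_pos 1
  have h2 := lintegral_gauss_eq two_pos one_pos
  have hval : (1 / 2 : ℝ) * 2 ^ (-1 / 2 : ℝ) * (2 * π) ^ (1 / 2 : ℝ) * Real.Gamma (1 / 2) =
      π / 2 := by
    rw [Real.Gamma_one_half_eq, Real.mul_rpow zero_le_two hp.le, neg_div,
      Real.rpow_neg zero_le_two, ← Real.sqrt_eq_rpow, ← Real.sqrt_eq_rpow]
    have := Real.mul_self_sqrt hp.le
    field_simp
    linarith
  rw [hval] at h2
  norm_num [lintegral_absSinc_sq] at h1 h2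
  rw [h2] at h1
  have hH : ∫⁻ τ in Ioi (0:ℝ), volume (absSinc ⁻¹' Ioi τ ∩ Ioi 0) * ENNReal.ofReal τ =
      ∫⁻ τ in Ioi (0:ℝ), ENNReal.ofReal ((distribFn absSinc τ).toReal * τ) := by
    refine setLIntegral_congr_fun measurableSet_Ioi fun τ hτ => ?_
    rw [ENNReal.ofReal_mul ENNReal.toReal_nonneg,
      ENNReal.ofReal_toReal (distribFn_absSinc_ne_top hτ), distribFn_absSinc]
  rw [hH] at h1
  refine ⟨((ENNReal.mul_right_inj two_ne_zero ENNReal.ofNat_ne_top).1 h1).symm, fun h => ?_⟩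
  rw [h] at h2
  simp at h2

/-- Ball's integral inequality in Lorentz form: for `q ≥ 2` and `0 < α ≤ 1`,
`∫₀^∞ ((sin t / t)*)^q t^{α−1} dt ≤ (1/2) q^{−α/2} (2π)^{α/2} Γ(α/2)`. -/
theorem statement7 (q α : ℝ) (hq : 2 ≤ q) (hα0 : 0 < α) (hα1 : α ≤ 1) :
    ∫⁻ t in Set.Ioi (0:ℝ),
        ENNReal.ofReal ((rearr (fun s => |Real.sin s / s|) t) ^ q * t ^ (α - 1)) ≤
      ENNReal.ofReal ((1 / 2) * q ^ (-α / 2) * (2 * π) ^ (α / 2) * Real.Gamma (α / 2)) := by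
  change ∫⁻ t in Set.Ioi (0:ℝ), ENNReal.ofReal ((rearr absSinc t) ^ q * t ^ (α - 1)) ≤ _
  have hq0 : 0 < q := by linarith
  rw [lintegral_rpow_mul_rpow_eq_lintegral_meas_lt antitone_rearr_absSinc.measurable
    rearr_absSinc_nonneg hq0, lintegral_gauss_eq hq0 hα0]
  refine mul_le_mul_right ?_ _
  set H : ℝ → ℝ := fun τ => (distribFn absSinc τ).toReal with hH
  have hHm : Measurable H := distribFn_absSinc_anti.measurable.ennreal_toReal
  have hGm := measurable_gaussDistrib
  calc _ ≤ ∫⁻ τ in Ioi (0:ℝ), ENNReal.ofReal (H τ ^ α / α * τ ^ (q - 1)) := by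
        refine setLIntegral_mono (by fun_prop) fun τ hτ => ?_
        have hH0 : 0 ≤ H τ := ENNReal.toReal_nonneg
        rw [ENNReal.ofReal_mul (by positivity), ← lintegral_Ioo_rpow hα0 hH0]
        gcongr
        exact rearr_absSinc_preimage_subset hτ
    _ ≤ _ := by
        obtain ⟨τ₀, hτ₀, hτ₁, hlt, hgt⟩ := exists_crossing
        have hG₀ := gaussDistrib_pos hτ₀ hτ₁
        set w : ℝ := gaussDistrib τ₀ ^ (α - 1) * τ₀ ^ (q - 2)
        have hw0 : 0 ≤ w := by positivity
        obtain ⟨hEq, hfin⟩ := lintegral_distribFn_absSinc_eq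
        have hmono : ∫⁻ τ in Ioi (0:ℝ), (ENNReal.ofReal (H τ ^ α / α * τ ^ (q - 1)) +
              ENNReal.ofReal w * ENNReal.ofReal (gaussDistrib τ * τ)) ≤
            ∫⁻ τ in Ioi (0:ℝ), (ENNReal.ofReal (gaussDistrib τ ^ α / α * τ ^ (q - 1)) +
              ENNReal.ofReal w * ENNReal.ofReal (H τ * τ)) := by
          refine setLIntegral_mono (by fun_prop) fun τ hτ => ?_
          have hτ : 0 < τ := hτ
          have hH0 : 0 ≤ H τ := ENNReal.toReal_nonneg
          have hG0 := gaussDistrib_nonneg τ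
          rw [← ENNReal.ofReal_mul hw0, ← ENNReal.ofReal_mul hw0,
            ← ENNReal.ofReal_add (by positivity) (by positivity),
            ← ENNReal.ofReal_add (by positivity) (by positivity)]
          apply ENNReal.ofReal_le_ofReal
          rcases le_or_gt 1 τ with h1 | h1
          · simp [hH, distribFn_absSinc_of_one_le h1, gaussDistrib_of_one_le h1]
          have htop := distribFn_absSinc_ne_top hτ
          refine rpow_mul_rpow_add_le hq hα0 hα1 hτ hτ₀ hH0 (gaussDistrib_pos hτ h1) hG₀
            (fun h => ⟨(ENNReal.ofReal_le_iff_le_toReal htop).1 (hlt τ hτ h),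
              gaussDistrib_anti hτ h.le⟩)
            (fun h => ⟨ENNReal.toReal_le_of_le_ofReal hG0 (hgt τ h),
              gaussDistrib_anti hτ₀ h.le⟩) (fun h => by rw [h])
        rw [lintegral_add_left (by fun_prop), lintegral_add_left (by fun_prop),
          lintegral_const_mul _ (by fun_prop), lintegral_const_mul _ (by fun_prop), hEq] at hmono
        exact (ENNReal.add_le_add_iff_right (ENNReal.mul_ne_top ENNReal.ofReal_ne_top hfin)).1 hmono
end
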